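/- arXiv:1710.00474 — 4 statements merged into one kernel-verified Lean document; each statement's English description precedes it below -/
import Mathlib

section
/- Let T ≥ 2 be an integer. For every t ∈ (0, π/T), one has (T+1)·sin t + sin((T+1)t) > 0 and (2/3)·sin t − ((2T/3) + 1)·sin((T−1)t) − ((T+1)/3)·sin((2T−1)t) < 0; in particular the quotient C₂(t) = ((T+1)sin t + sin((T+1)t)) / ((2/3)sin t − ((2T/3)+1)sin((T−1)t) − ((T+1)/3)sin((2T−1)t)) is negative on (0, π/T). -/
open Real Set

theorem abs_sin_nat_mul_le {t : ℝ} (ht : 0 ≤ sin t) (n : ℕ) :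
    |sin (n * t)| ≤ n * sin t := by
  induction n with
  | zero => simp
  | succ n ih =>
    rw [Nat.cast_succ, add_mul, one_mul, sin_add]
    calc |sin (n * t) * cos t + cos (n * t) * sin t|
        ≤ |sin (n * t)| * |cos t| + |cos (n * t)| * |sin t| := by
          simpa only [abs_mul] using abs_add_le (sin (n * t) * cos t) (cos (n * t) * sin t)
      _ ≤ n * sin t * 1 + 1 * sin t := by
          rw [abs_of_nonneg ht]
          gcongr
          · exact abs_cos_le_one t
          · exact abs_cos_le_one _
      _ = (n + 1) * sin t := by ring

theorem abs_sin_succ_mul_lt {t : ℝ} {n : ℕ} (hn : 0 < n) (ht : 0 < sin t) :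
    |sin (((n:ℝ) + 1) * t)| < (n + 1) * sin t := by
  have hn' : (0:ℝ) < n := by exact_mod_cast hn
  have hcos : |cos t| < 1 := by
    rw [← sq_lt_one_iff_abs_lt_one]
    nlinarith [sin_sq_add_cos_sq t]
  rw [add_mul, one_mul, sin_add]
  calc |sin (n * t) * cos t + cos (n * t) * sin t|
      ≤ |sin (n * t)| * |cos t| + |cos (n * t)| * |sin t| := by
        simpa only [abs_mul] using abs_add_le (sin (n * t) * cos t) (cos (n * t) * sin t)
    _ ≤ n * sin t * |cos t| + 1 * sin t := by
        rw [abs_of_pos ht]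
        gcongr
        · exact abs_sin_nat_mul_le ht.le n
        · exact abs_cos_le_one _
    _ < n * sin t * 1 + 1 * sin t := by gcongr
    _ = (n + 1) * sin t := by ring

/-- For `T ≥ 2` and `t ∈ (0, π/T)`: `(T+1)·sin t + sin((T+1)t) > 0`,
`(2/3)·sin t − ((2T/3)+1)·sin((T−1)t) − ((T+1)/3)·sin((2T−1)t) < 0`, and hence
`C₂(t) < 0` on `(0, π/T)`. -/
theorem C2_negative (T : ℕ) (hT : 2 ≤ T) (t : ℝ) (ht : t ∈ Set.Ioo 0 (Real.pi / T)) :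
    0 < ((T:ℝ)+1) * Real.sin t + Real.sin (((T:ℝ)+1) * t) ∧
    (2/3) * Real.sin t - (2*(T:ℝ)/3 + 1) * Real.sin (((T:ℝ)-1) * t) -
        (((T:ℝ)+1)/3) * Real.sin ((2*(T:ℝ)-1) * t) < 0 ∧
    (((T:ℝ)+1) * Real.sin t + Real.sin (((T:ℝ)+1) * t)) /
        ((2/3) * Real.sin t - (2*(T:ℝ)/3 + 1) * Real.sin (((T:ℝ)-1) * t) -
          (((T:ℝ)+1)/3) * Real.sin ((2*(T:ℝ)-1) * t)) < 0 := by
  obtain ⟨ht0, ht1⟩ := ht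
  have hT' : (2:ℝ) ≤ T := by exact_mod_cast hT
  have hTt : (T:ℝ) * t < π := by
    rw [lt_div_iff₀ (by linarith)] at ht1
    linarith
  have htπ : t < π := by nlinarith
  have hsin : 0 < sin t := sin_pos_of_pos_of_lt_pi ht0 htπ
  have hsin' : 0 < sin (((T:ℝ) - 1) * t) :=
    sin_pos_of_pos_of_lt_pi (by nlinarith) (by nlinarith)
  have hnum : 0 < ((T:ℝ) + 1) * sin t + sin (((T:ℝ) + 1) * t) := by
    have h := abs_sin_succ_mul_lt (n := T) (by omega) hsin
    linarith [neg_abs_le (sin (((T:ℝ) + 1) * t))]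
  have hden : (2/3) * sin t - (2*(T:ℝ)/3 + 1) * sin (((T:ℝ)-1) * t) -
      (((T:ℝ)+1)/3) * sin ((2*(T:ℝ)-1) * t) < 0 := by
    have key : sin ((2*(T:ℝ)-1) * t) =
        2 * cos (T * t) * sin (((T:ℝ)-1) * t) + sin t := by
      have h₁ : (2*(T:ℝ)-1) * t = ((T:ℝ)-1) * t + T * t := by ring
      have h₂ : sin t = sin (T * t - ((T:ℝ)-1) * t) := by ring_nf
      rw [h₁, h₂, sin_add, sin_sub]
      ring
    have hcoef : 0 < 2 * (T:ℝ) + 3 + 2 * (T + 1) * cos (T * t) := by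
      nlinarith [neg_one_le_cos ((T:ℝ) * t)]
    rw [key]
    nlinarith [mul_pos hcoef hsin', mul_pos (by linarith : (0:ℝ) < T - 1) hsin]
  exact ⟨hnum, hden, div_neg_of_pos_of_neg hnum hden⟩
end

section
/- Let T ≥ 2 be an integer, let α ∈ [0, 2/3], and let γ > 0. Then every complex root z of the cubic polynomial Φ₂(z) = γ(T−1)(1−α)z³ + γ(T(2T+1)(1−α) − 1)z² + (T+1)(γα(T−1) + 1)z + (T+1) satisfies Re z < 0. -/
open Complex

/-- The Routh–Hurwitz criterion for cubics with positive real coefficients. -/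
theorem re_neg_of_cubic_eq_zero {a b c d : ℝ} (ha : 0 < a) (hb : 0 < b) (hc : 0 < c)
    (hd : 0 < d) (h : a * d < b * c) {z : ℂ}
    (hz : (a : ℂ) * z ^ 3 + b * z ^ 2 + c * z + d = 0) : z.re < 0 := by
  obtain ⟨x, y⟩ := z
  have hre := congrArg Complex.re hz
  have him := congrArg Complex.im hz
  simp only [pow_succ, pow_zero, one_mul, add_re, add_im, mul_re, mul_im, ofReal_re, ofReal_im,
    zero_re, zero_im] at hre him
  by_contra! hx
  change 0 ≤ x at hx
  have him' : y * (a * (3 * x ^ 2 - y ^ 2) + 2 * b * x + c) = 0 := by linear_combination him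
  rcases mul_eq_zero.mp him' with rfl | hy
  · have : 0 < a * x ^ 3 + b * x ^ 2 + c * x + d := by positivity
    linarith
  · have key : 8 * a ^ 2 * x ^ 3 + 8 * a * b * x ^ 2 + 2 * (a * c + b ^ 2) * x
        + (b * c - a * d) = 0 := by
      linear_combination (-a) * hre + (3 * a * x + b) * hy
    have : 0 ≤ 8 * a ^ 2 * x ^ 3 + 8 * a * b * x ^ 2 + 2 * (a * c + b ^ 2) * x := by positivity
    linarith

/-- For `T ≥ 2`, `α ∈ [0, 2/3]` and `γ > 0`, every complex root of the cubic
`Φ₂(z) = γ(T−1)(1−α)z³ + γ(T(2T+1)(1−α)−1)z² + (T+1)(γα(T−1)+1)z + (T+1)`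
has negative real part. -/
theorem Phi₂_roots_re_neg (T : ℕ) (hT : 2 ≤ T) (α : ℝ) (hα0 : 0 ≤ α) (hα1 : α ≤ 2/3)
    (γ : ℝ) (hγ : 0 < γ) (z : ℂ)
    (hz : ((γ:ℂ) * ((T:ℂ) - 1) * (1 - (α:ℂ))) * z^3 +
        ((γ:ℂ) * ((T:ℂ) * (2*(T:ℂ) + 1) * (1 - (α:ℂ)) - 1)) * z^2 +
        (((T:ℂ) + 1) * ((γ:ℂ) * (α:ℂ) * ((T:ℂ) - 1) + 1)) * z + ((T:ℂ) + 1) = 0) :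
    z.re < 0 := by
  have hT' : (2 : ℝ) ≤ T := by exact_mod_cast hT
  have hα : 1 / 3 ≤ 1 - α := by linarith
  have hgap : 0 < (2 * (T : ℝ) ^ 2 + 1) * (1 - α) - 1 := by nlinarith
  have ha : 0 < (T - 1 : ℝ) * (1 - α) := mul_pos (by linarith) (by linarith)
  have hb : (T - 1 : ℝ) * (1 - α) < T * (2 * T + 1) * (1 - α) - 1 := by linarith
  have hc : 0 ≤ γ * α * (T - 1 : ℝ) := mul_nonneg (by positivity) (by linarith)
  have hab : γ * (T - 1 : ℝ) * (1 - α) < γ * (T * (2 * T + 1) * (1 - α) - 1) := by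
    rw [mul_assoc]
    exact mul_lt_mul_of_pos_left hb hγ
  have ha' : 0 < γ * (T - 1 : ℝ) * (1 - α) := by
    rw [mul_assoc]
    exact mul_pos hγ ha
  refine re_neg_of_cubic_eq_zero (a := γ * (T - 1) * (1 - α))
    (b := γ * (T * (2 * T + 1) * (1 - α) - 1)) (c := (T + 1) * (γ * α * (T - 1) + 1))
    (d := T + 1) ha' (ha'.trans hab) (by positivity) (by positivity) ?_ ?_
  · exact mul_lt_mul hab (le_mul_of_one_le_right (by positivity) (by linarith)) (by positivity)
      (ha'.trans hab).le
  · push_cast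
    exact hz
end

section
/- Let T ≥ 2 be an integer and let α ∈ [0, 2/3]. Then ((2T²+1)(1−α) − 1)² − 4(T−1)²(1−α)(α(T+2) − 1) > 0. -/
/-- For `T ≥ 2` and `α ∈ [0, 2/3]`, the discriminant quantity
`((2T²+1)(1−α) − 1)² − 4(T−1)²(1−α)(α(T+2) − 1)` is positive. -/
theorem discriminant_pos (T : ℕ) (hT : 2 ≤ T) (α : ℝ) (hα0 : 0 ≤ α) (hα1 : α ≤ 2/3) :
    0 < ((2*(T:ℝ)^2 + 1)*(1 - α) - 1)^2 -
      4*((T:ℝ) - 1)^2*(1 - α)*(α*((T:ℝ) + 2) - 1) := by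
  have hT' : (2 : ℝ) ≤ T := by exact_mod_cast hT
  generalize (T : ℝ) = t at hT' ⊢
  obtain ⟨s, rfl⟩ : ∃ s, t = s + 2 := ⟨t - 2, by ring⟩
  obtain ⟨u, rfl⟩ : ∃ u, α = 2 / 3 - u := ⟨2 / 3 - α, by ring⟩
  have hs : 0 ≤ s := by linarith
  have hu : 0 ≤ u := by linarith
  -- Taylor expansion at `α = 2 / 3`; all coefficients are nonnegative in `s = T - 2`.
  have key : ((2*(s + 2)^2 + 1)*(1 - (2 / 3 - u)) - 1)^2 -
      4*((s + 2) - 1)^2*(1 - (2 / 3 - u))*((2 / 3 - u)*((s + 2) + 2) - 1) =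
      4 / 9 * (s + 1)^2 * (s + 2)^2 +
      4 / 3 * (s + 2) * (2*s^3 + 11*s^2 + 22*s + 13) * u +
      ((2*(s + 2)^2 + 1)^2 + 4*(s + 1)^2*(s + 4)) * u^2 := by ring
  rw [key]
  positivity
end

section
/- Fix α ∈ (0, 2/3]. For each integer T with T ≥ 2 and α > 1/(T+2), let γ₀(T) = (1/2)·( (T+1)((2T²+1)(1−α) − 1) / ((T−1)²(1−α)(α(T+2) − 1)) − √𝒟(T) ), where 𝒟(T) = (T+1)²·(((2T²+1)(1−α) − 1)² − 4(T−1)²(1−α)(α(T+2) − 1)) / ((T−1)²(1−α)(α(T+2) − 1))². Then T·γ₀(T) converges to 1/(2(1−α)) as T → ∞. -/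
open Filter

/-- The discriminant-type quantity `𝒟(T)`. -/
noncomputable def scrD (T : ℕ) (α : ℝ) : ℝ :=
  ((T:ℝ)+1)^2 * (((2*(T:ℝ)^2+1)*(1-α) - 1)^2 - 4*((T:ℝ)-1)^2*(1-α)*(α*((T:ℝ)+2) - 1)) /
    (((T:ℝ)-1)^2*(1-α)*(α*((T:ℝ)+2) - 1))^2

/-- The local-univalence threshold
`γ₀(T) = ½·((T+1)((2T²+1)(1−α)−1)/((T−1)²(1−α)(α(T+2)−1)) − √𝒟(T))`
(the relevant case `α > 1/(T+2)`, which holds for all large `T` once `α > 0`). -/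
noncomputable def gamma₀ (T : ℕ) (α : ℝ) : ℝ :=
  (1/2) * (((T:ℝ)+1)*((2*(T:ℝ)^2+1)*(1-α) - 1) /
      (((T:ℝ)-1)^2*(1-α)*(α*((T:ℝ)+2) - 1)) - Real.sqrt (scrD T α))

/-- Rationalized form of the smaller root of a quadratic, scaled by `k`. -/
lemma mul_div_sub_sqrt_eq {k P D : ℝ} (hk : 0 ≤ k) (hP : 0 < P) (hD : 0 < D)
    (hPD : 0 ≤ P ^ 2 - 4 * D) :
    k * P / D - √(k ^ 2 * (P ^ 2 - 4 * D) / D ^ 2) = 4 * k / (P + √(P ^ 2 - 4 * D)) := by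
  rw [Real.sqrt_div' _ (sq_nonneg D), Real.sqrt_mul (sq_nonneg k), Real.sqrt_sq hk,
    Real.sqrt_sq hD.le, ← sub_div,
    div_eq_div_iff hD.ne' (by positivity : P + √(P ^ 2 - 4 * D) ≠ 0)]
  linear_combination -k * Real.sq_sqrt hPD

/-- `γ₀` rescaled by `T`, in terms of `x = 1 / T`. -/
lemma natCast_mul_gamma₀_eq {T : ℕ} {α x p d : ℝ} (hT : 0 < T) (hx : x = (T : ℝ)⁻¹)
    (hp : p = (2 + x ^ 2) * (1 - α) - x ^ 2)
    (hd : d = (1 - x) ^ 2 * (1 - α) * (α * (1 + 2 * x) - x))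
    (hp0 : 0 < p) (hd0 : 0 < d) (hpd : 0 < p ^ 2 - 4 * (x * d)) :
    (T : ℝ) * gamma₀ T α = 2 * (1 + x) / (p + √(p ^ 2 - 4 * (x * d))) := by
  have hT0 : (0 : ℝ) < T := by exact_mod_cast hT
  have hP : (2 * (T : ℝ) ^ 2 + 1) * (1 - α) - 1 = T ^ 2 * p := by
    rw [hp, hx]; field_simp
  have hD : ((T : ℝ) - 1) ^ 2 * (1 - α) * (α * ((T : ℝ) + 2) - 1) = T ^ 3 * d := by
    rw [hd, hx]; field_simp
  have hdisc : (T ^ 2 * p) ^ 2 - 4 * (T ^ 3 * d) = ((T : ℝ) ^ 2) ^ 2 * (p ^ 2 - 4 * (x * d)) := by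
    rw [hx]; field_simp
  have hassoc : 4 * ((T : ℝ) - 1) ^ 2 * (1 - α) * (α * ((T : ℝ) + 2) - 1) = 4 * (T ^ 3 * d) := by
    rw [← hD]; ring
  have hroot := mul_div_sub_sqrt_eq (k := (T : ℝ) + 1) (P := T ^ 2 * p) (D := T ^ 3 * d)
    (by positivity) (by positivity) (by positivity) (by rw [hdisc]; positivity)
  rw [gamma₀, scrD, hassoc, hD, hP, hroot, hdisc, Real.sqrt_mul (by positivity),
    Real.sqrt_sq (by positivity)]
  have hne : p + √(p ^ 2 - 4 * (x * d)) ≠ 0 := by positivity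
  have hx1 : (T : ℝ) * x = 1 := by rw [hx]; exact mul_inv_cancel₀ hT0.ne'
  rw [← mul_add, eq_div_iff hne]
  field_simp
  linear_combination -4 * hx1

/-- For fixed `α ∈ (0, 2/3]`, `T·γ₀(T) → 1/(2(1−α))` as `T → ∞`. -/
theorem gamma₀_asymptotic (α : ℝ) (hα0 : 0 < α) (hα1 : α ≤ 2/3) :
    Filter.Tendsto (fun T : ℕ => (T:ℝ) * gamma₀ T α) Filter.atTop
      (nhds (1 / (2*(1 - α)))) := by
  have hα : 0 < 1 - α := by linarith
  let p : ℝ → ℝ := fun x ↦ (2 + x ^ 2) * (1 - α) - x ^ 2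
  let d : ℝ → ℝ := fun x ↦ (1 - x) ^ 2 * (1 - α) * (α * (1 + 2 * x) - x)
  let q : ℝ → ℝ := fun x ↦ p x ^ 2 - 4 * (x * d x)
  have hp : Continuous p := by fun_prop
  have hd : Continuous d := by fun_prop
  have hq : Continuous q := by fun_prop
  have hp0 : p 0 = 2 * (1 - α) := by simp [p]
  have hd0 : d 0 = (1 - α) * α := by simp [d]
  have hq0 : q 0 = (2 * (1 - α)) ^ 2 := by simp [q, hp0]
  have hsqrt : √(q 0) = 2 * (1 - α) := by rw [hq0, Real.sqrt_sq (by positivity)]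
  have hinv : Tendsto (fun T : ℕ ↦ (T : ℝ)⁻¹) atTop (nhds 0) := tendsto_inv_atTop_nhds_zero_nat
  have hlim : ContinuousAt (fun x ↦ 2 * (1 + x) / (p x + √(q x))) 0 := by
    refine ContinuousAt.div (by fun_prop) (by fun_prop) ?_
    rw [hsqrt, hp0]
    positivity
  have hval : 2 * (1 + 0) / (p 0 + √(q 0)) = 1 / (2 * (1 - α)) := by
    rw [hsqrt, hp0]
    field_simp
    norm_num
  have hev {f : ℝ → ℝ} (hf : Continuous f) (h0 : 0 < f 0) :
      ∀ᶠ T : ℕ in atTop, 0 < f (T : ℝ)⁻¹ :=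
    hinv.eventually (hf.continuousAt.eventually_const_lt h0)
  rw [← hval]
  refine (hlim.tendsto.comp hinv).congr' ?_
  filter_upwards [eventually_gt_atTop 0, hev hp (by rw [hp0]; positivity),
    hev hd (by rw [hd0]; positivity), hev hq (by rw [hq0]; positivity)] with T hT hpT hdT hqT
  exact (natCast_mul_gamma₀_eq hT rfl rfl rfl hpT hdT hqT).symm
end
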